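/- arXiv:1307.2520 — 2 statements merged into one kernel-verified Lean document; each statement's English description precedes it below -/
import Mathlib

section
/- Let P be a finite nonempty subset of a metric space M and let k, ℓ be integers with 1 ≤ ℓ ≤ k ≤ |P|, and set m = ⌊k/ℓ⌋. Then σ_med ≤ 2·σ_opt, where σ_med is the optimal (non-fault-tolerant) m-median cost of P and σ_opt is the optimal fault-tolerant k-median cost of P with fault-tolerance parameter ℓ. -/
/-- `kthDist S p i` is the `i`-th smallest value (1-indexed) among the distances
`dist p s` for `s ∈ S`, i.e. the radius of the smallest closed ball centered at `p`
containing at least `i` points of `S`. -/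
noncomputable def kthDist {M : Type*} [MetricSpace M] (S : Finset M) (p : M) (i : ℕ) : ℝ :=
  ((S.val.map (fun s => dist p s)).sort (· ≤ ·)).getD (i - 1) 0

theorem le_card_filter_dist_le_kthDist {M : Type*} [MetricSpace M] (S : Finset M) (p : M) {i : ℕ}
    (hi : 1 ≤ i) (hiS : i ≤ S.card) :
    i ≤ (S.filter fun s => dist p s ≤ kthDist S p i).card := by
  set t := kthDist S p i with ht
  unfold kthDist at ht
  set L := (S.val.map (fun s => dist p s)).sort (· ≤ ·) with hL
  have hlen : L.length = S.card := by simp [hL]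
  have hsort : L.Pairwise (· ≤ ·) := Multiset.pairwise_sort _ _
  have hcoe : (L : Multiset ℝ) = S.val.map (fun s => dist p s) := Multiset.sort_eq _ _
  have hcount : (S.filter fun s => dist p s ≤ t).card = L.countP (fun x => x ≤ t) := by
    rw [← Multiset.coe_countP, hcoe, Multiset.countP_map]
    rfl
  have htake : (L.take i).countP (fun x => x ≤ t) = (L.take i).length := by
    rw [List.countP_eq_length]
    intro x hx
    obtain ⟨j, hj, rfl⟩ := List.mem_iff_getElem.1 hx
    rw [List.length_take] at hj
    rw [List.getD_eq_getElem _ _ (by omega)] at ht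
    rw [List.getElem_take, ht, decide_eq_true_iff]
    exact hsort.rel_get_of_le (a := ⟨j, by omega⟩) (b := ⟨i - 1, by omega⟩)
      (by simp only [Fin.mk_le_mk]; omega)
  calc i = (L.take i).length := by rw [List.length_take]; omega
    _ = (L.take i).countP (fun x => x ≤ t) := htake.symm
    _ ≤ L.countP (fun x => x ≤ t) := (List.take_sublist i L).countP_le
    _ = _ := hcount.symm

theorem kthDist_one_le_dist {M : Type*} [MetricSpace M] {S : Finset M} (p : M) {s : M}
    (hs : s ∈ S) : kthDist S p 1 ≤ dist p s := by
  unfold kthDist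
  set L := (S.val.map (fun s => dist p s)).sort (· ≤ ·) with hL
  have hsort : L.Pairwise (· ≤ ·) := Multiset.pairwise_sort _ _
  have hmem : dist p s ∈ L := by
    rw [hL, Multiset.mem_sort]
    exact Multiset.mem_map_of_mem _ hs
  obtain ⟨j, hj, hjs⟩ := List.mem_iff_getElem.1 hmem
  rw [List.getD_eq_getElem _ _ (by omega), ← hjs]
  exact hsort.rel_get_of_le (a := ⟨0, by omega⟩) (b := ⟨j, hj⟩) (by simp)

/-- Greedy selection in order of increasing `r`: a subset of `P` on which the sets `N p` are
pairwise disjoint and such that each `N p` meets a selected `N q` with `r q ≤ r p`. -/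
theorem exists_pairwiseDisjoint_subset {α β : Type*} (P : Finset α) (r : α → ℝ)
    (N : α → Finset β) (hN : ∀ p ∈ P, (N p).Nonempty) :
    ∃ Q ⊆ P, (Q : Set α).PairwiseDisjoint N ∧
      ∀ p ∈ P, ∃ q ∈ Q, r q ≤ r p ∧ ¬ Disjoint (N p) (N q) := by
  classical
  induction P using Finset.induction_on_max_value r with
  | empty => exact ⟨∅, by simp⟩
  | insert a s _ hmax ih =>
    obtain ⟨Q, hQs, hdisj, hcov⟩ := ih fun p hp => hN p (Finset.mem_insert_of_mem hp)
    by_cases h : ∀ q ∈ Q, Disjoint (N a) (N q)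
    · refine ⟨insert a Q, Finset.insert_subset_insert a hQs, ?_, ?_⟩
      · rw [Finset.coe_insert]
        exact hdisj.insert fun q hq _ => h q hq
      · intro p hp
        rcases Finset.mem_insert.1 hp with rfl | hp'
        · refine ⟨p, Finset.mem_insert_self _ _, le_rfl, ?_⟩
          rw [disjoint_self]
          exact (hN p hp).ne_empty
        · obtain ⟨q, hq, hqp⟩ := hcov p hp'
          exact ⟨q, Finset.mem_insert_of_mem hq, hqp⟩
    · push Not at h
      obtain ⟨q, hq, hnd⟩ := h
      refine ⟨Q, hQs.trans (Finset.subset_insert a s), hdisj, fun p hp => ?_⟩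
      rcases Finset.mem_insert.1 hp with rfl | hp'
      · exact ⟨q, hq, hmax q (hQs hq), hnd⟩
      · exact hcov p hp'

/-- Let `P` be a finite nonempty subset of a metric space, `1 ≤ ℓ ≤ k ≤ |P|`,
and `m = ⌊k/ℓ⌋`.  Then `σ_med ≤ 2·σ_opt`, where `σ_med` is the optimal non-fault-tolerant
`m`-median cost of `P` and `σ_opt` is the optimal fault-tolerant `k`-median cost of `P` with
fault-tolerance parameter `ℓ`. -/
theorem med_le_two_mul_opt {M : Type*} [MetricSpace M]
    (P : Finset M) (hP : P.Nonempty) (k ℓ : ℕ)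
    (hl1 : 1 ≤ ℓ) (hlk : ℓ ≤ k) (hkP : k ≤ P.card)
    (σopt σmed : ℝ)
    (hopt : IsLeast {x : ℝ | ∃ C : Finset M, C ⊆ P ∧ C.card = k ∧
      x = ∑ p ∈ P, kthDist C p ℓ} σopt)
    (hmed : IsLeast {x : ℝ | ∃ Q : Finset M, Q ⊆ P ∧ Q.card = k / ℓ ∧
      x = ∑ p ∈ P, kthDist Q p 1} σmed) :
    σmed ≤ 2 * σopt := by
  classical
  obtain ⟨C, -, hCk, rfl⟩ := hopt.1
  set r : M → ℝ := fun p => kthDist C p ℓ with hr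
  set N : M → Finset M := fun p => C.filter fun s => dist p s ≤ r p with hN
  have hNcard : ∀ p, ℓ ≤ (N p).card := fun p =>
    le_card_filter_dist_le_kthDist C p hl1 (hCk ▸ hlk)
  obtain ⟨Q, hQP, hdisj, hcov⟩ := exists_pairwiseDisjoint_subset P r N
    fun p _ => Finset.card_pos.1 (hl1.trans (hNcard p))
  have hQcard : Q.card ≤ k / ℓ := by
    rw [Nat.le_div_iff_mul_le hl1, ← hCk]
    calc Q.card * ℓ ≤ ∑ q ∈ Q, (N q).card := by
          simpa using Finset.card_nsmul_le_sum Q _ ℓ fun q _ => hNcard q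
      _ = (Q.biUnion N).card := (Finset.card_biUnion hdisj).symm
      _ ≤ C.card := Finset.card_le_card <|
          Finset.biUnion_subset.2 fun q _ => Finset.filter_subset _ _
  obtain ⟨Q', hQQ', hQ'P, hQ'card⟩ :=
    Finset.exists_subsuperset_card_eq hQP hQcard ((Nat.div_le_self k ℓ).trans hkP)
  refine (hmed.2 ⟨Q', hQ'P, hQ'card, rfl⟩).trans ?_
  rw [Finset.mul_sum]
  refine Finset.sum_le_sum fun p hp => ?_
  obtain ⟨q, hq, hqp, hnd⟩ := hcov p hp
  obtain ⟨c, hcp, hcq⟩ := Finset.not_disjoint_iff.1 hnd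
  have hpc : dist p c ≤ r p := (Finset.mem_filter.1 hcp).2
  have hqc : dist q c ≤ r q := (Finset.mem_filter.1 hcq).2
  calc kthDist Q' p 1 ≤ dist p q := kthDist_one_le_dist p (hQQ' hq)
    _ ≤ dist p c + dist q c := dist_triangle_right p q c
    _ ≤ 2 * kthDist C p ℓ := by linarith
end

section
/- Let P be a finite nonempty subset of a metric space M, let k, ℓ be integers with 1 ≤ ℓ ≤ k ≤ |P|, and set m = ⌊k/ℓ⌋. Let c ≥ 0 be a real number and let Q ⊆ P with |Q| = m be a c-approximate m-median solution, i.e. Σ_{p ∈ P} dist_1(Q, p) ≤ c·σ_med. Suppose C ⊆ P is obtained by choosing, for each q ∈ Q, a set N_q of exactly ℓ points of P each within distance dist_ℓ(P, q) of q, and taking C = ∪_{q ∈ Q} N_q. Then |C| ≤ k and Σ_{p ∈ P} dist_ℓ(C, p) ≤ (1 + 4c)·σ_opt. -/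
theorem List.Pairwise.getD_le_iff_lt_countP {α : Type*} [LinearOrder α] {L : List α}
    (hL : L.Pairwise (· ≤ ·)) (d r : α) {n : ℕ} (hn : n < L.length) :
    L.getD n d ≤ r ↔ n < L.countP (· ≤ r) := by
  induction L generalizing n with
  | nil => simp at hn
  | cons a l ih =>
    obtain ⟨ha, hl⟩ := List.pairwise_cons.1 hL
    by_cases har : a ≤ r
    · cases n with
      | zero => simp [har]
      | succ n =>
        have := ih hl (n := n) (by simpa using hn)
        simpa [har] using this
    · have hall : ∀ x ∈ a :: l, ¬ x ≤ r := by
        intro x hx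
        rcases List.mem_cons.1 hx with rfl | hx
        · exact har
        · exact fun h => har ((ha x hx).trans h)
      have hcount : (a :: l).countP (· ≤ r) = 0 := by
        rw [List.countP_eq_zero]
        simpa using hall
      rw [hcount, List.getD_eq_getElem _ _ hn]
      simpa using hall _ (List.getElem_mem hn)

section kthDist

variable {M : Type*} [MetricSpace M]

theorem kthDist_le_iff {S : Finset M} {p : M} {i : ℕ} (hi : 1 ≤ i) (hiS : i ≤ S.card) (r : ℝ) :
    kthDist S p i ≤ r ↔ i ≤ (S.filter (fun s => dist p s ≤ r)).card := by
  have hcount : ((S.val.map (fun s => dist p s)).sort (· ≤ ·)).countP (· ≤ r) =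
      (S.filter (fun s => dist p s ≤ r)).card := by
    rw [← Multiset.coe_countP, Multiset.sort_eq, Multiset.countP_map]
    rfl
  unfold kthDist
  rw [(Multiset.pairwise_sort _ _).getD_le_iff_lt_countP 0 r
    (by simp only [Multiset.length_sort, Multiset.card_map, Finset.card_val]; omega), hcount]
  omega

theorem kthDist_le_of_subset {S T : Finset M} {p : M} {i : ℕ} {r : ℝ} (hi : 1 ≤ i)
    (hTS : T ⊆ S) (hT : i ≤ T.card) (h : ∀ t ∈ T, dist p t ≤ r) : kthDist S p i ≤ r :=
  (kthDist_le_iff hi (hT.trans (Finset.card_le_card hTS)) r).2 <|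
    hT.trans <| Finset.card_le_card fun t ht => Finset.mem_filter.2 ⟨hTS ht, h t ht⟩

theorem exists_subset_card_eq_dist_le_kthDist {S : Finset M} (p : M) {i : ℕ} (hi : 1 ≤ i)
    (hiS : i ≤ S.card) :
    ∃ T ⊆ S, T.card = i ∧ ∀ t ∈ T, dist p t ≤ kthDist S p i := by
  obtain ⟨T, hT, hcard⟩ := Finset.exists_subset_card_eq ((kthDist_le_iff hi hiS _).1 le_rfl)
  exact ⟨T, hT.trans (Finset.filter_subset _ _), hcard, fun t ht => (Finset.mem_filter.1 (hT ht)).2⟩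

theorem kthDist_anti {S T : Finset M} (p : M) {i : ℕ} (hi : 1 ≤ i) (hTS : T ⊆ S)
    (hT : i ≤ T.card) : kthDist S p i ≤ kthDist T p i := by
  obtain ⟨U, hUT, hU, h⟩ := exists_subset_card_eq_dist_le_kthDist p hi hT
  exact kthDist_le_of_subset hi (hUT.trans hTS) hU.ge h

theorem kthDist_le_dist_add {S : Finset M} (p q : M) {i : ℕ} (hi : 1 ≤ i) (hiS : i ≤ S.card) :
    kthDist S p i ≤ dist p q + kthDist S q i := by
  obtain ⟨T, hTS, hT, h⟩ := exists_subset_card_eq_dist_le_kthDist q hi hiS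
  exact kthDist_le_of_subset hi hTS hT.ge fun t ht =>
    (dist_triangle p q t).trans (by linarith [h t ht])

theorem kthDist_one_le {S : Finset M} {p s : M} (hs : s ∈ S) : kthDist S p 1 ≤ dist p s :=
  kthDist_le_of_subset (T := {s}) le_rfl (by simpa using hs) (by simp) (by simp)

theorem exists_mem_dist_le_kthDist_one {S : Finset M} (hS : S.Nonempty) (p : M) :
    ∃ s ∈ S, dist p s ≤ kthDist S p 1 := by
  obtain ⟨T, hTS, hT, h⟩ := exists_subset_card_eq_dist_le_kthDist p le_rfl hS.card_pos
  obtain ⟨t, ht⟩ := Finset.card_pos.1 (hT ▸ Nat.one_pos)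
  exact ⟨t, hTS ht, h t ht⟩

end kthDist

/-- Greedy selection in order of increasing `r`: a subfamily of pairwise disjoint sets such that
every set of the family meets a selected one of no larger `r`-value. -/
theorem Finset.exists_pairwiseDisjoint_subset_forall_not_disjoint {α β : Type*}
    (P : Finset α) (r : α → ℝ) (B : α → Finset β)
    (hB : ∀ p ∈ P, (B p).Nonempty) :
    ∃ G ⊆ P, (G : Set α).PairwiseDisjoint B ∧
      ∀ p ∈ P, ∃ q ∈ G, r q ≤ r p ∧ ¬ Disjoint (B p) (B q) := by
  classical
  induction P using Finset.induction_on_max_value r with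
  | empty => exact ⟨∅, by simp⟩
  | insert a s has hmax ih =>
    obtain ⟨G, hGs, hG, hcov⟩ := ih fun p hp => hB p (Finset.mem_insert_of_mem hp)
    by_cases h : ∃ q ∈ G, ¬ Disjoint (B a) (B q)
    · obtain ⟨q, hq, hd⟩ := h
      refine ⟨G, hGs.trans (Finset.subset_insert _ _), hG, fun p hp => ?_⟩
      rcases Finset.mem_insert.1 hp with rfl | hp
      · exact ⟨q, hq, hmax q (hGs hq), hd⟩
      · exact hcov p hp
    · push Not at h
      refine ⟨insert a G, Finset.insert_subset_insert _ hGs, ?_, fun p hp => ?_⟩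
      · rw [Finset.coe_insert]
        exact hG.insert fun q hq _ => h q hq
      · rcases Finset.mem_insert.1 hp with rfl | hp
        · refine ⟨p, Finset.mem_insert_self _ _, le_rfl, fun hd => ?_⟩
          exact (hB p (Finset.mem_insert_self _ _)).ne_empty (disjoint_self.1 hd)
        · obtain ⟨q, hq, hqp⟩ := hcov p hp
          exact ⟨q, Finset.mem_insert_of_mem hq, hqp⟩

/-- Any fault-tolerant solution with `k` centers yields a median solution with `k / ℓ` centers
whose cost is at most twice as large, pointwise. -/
theorem exists_kthDist_one_le_two_mul {M : Type*} [MetricSpace M] {P D : Finset M} {ℓ : ℕ}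
    (hl : 1 ≤ ℓ) (hlD : ℓ ≤ D.card) (hDP : D ⊆ P) :
    ∃ Q ⊆ P, Q.card = D.card / ℓ ∧ ∀ p ∈ P, kthDist Q p 1 ≤ 2 * kthDist D p ℓ := by
  classical
  choose B hBD hBcard hB using
    fun p : M => exists_subset_card_eq_dist_le_kthDist (S := D) p hl hlD
  obtain ⟨G, hGP, hG, hcov⟩ := P.exists_pairwiseDisjoint_subset_forall_not_disjoint
    (fun p => kthDist D p ℓ) B fun p _ => Finset.card_pos.1 (by rw [hBcard]; exact hl)
  have hGcard : G.card ≤ D.card / ℓ := by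
    rw [Nat.le_div_iff_mul_le hl, ← Finset.sum_const_nat fun p (_ : p ∈ G) => hBcard p,
      ← Finset.card_biUnion hG]
    exact Finset.card_le_card (Finset.biUnion_subset.2 fun p _ => hBD p)
  obtain ⟨Q, hGQ, hQP, hQ⟩ := Finset.exists_subsuperset_card_eq hGP hGcard
    ((Nat.div_le_self _ _).trans (Finset.card_le_card hDP))
  refine ⟨Q, hQP, hQ, fun p hp => ?_⟩
  obtain ⟨q, hq, hqp, hd⟩ := hcov p hp
  obtain ⟨x, hxp, hxq⟩ := Finset.not_disjoint_iff.1 hd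
  have hqp : kthDist D q ℓ ≤ kthDist D p ℓ := hqp
  calc kthDist Q p 1 ≤ dist p q := kthDist_one_le (hGQ hq)
    _ ≤ dist p x + dist q x := dist_triangle_right _ _ _
    _ ≤ 2 * kthDist D p ℓ := by linarith [hB p x hxp, hB q x hxq]

/-- Let `P` be a finite nonempty subset of a metric space,
`1 ≤ ℓ ≤ k ≤ |P|`, `m = ⌊k/ℓ⌋`.  Let `c ≥ 0` and `Q ⊆ P` with `|Q| = m` be a
`c`-approximate `m`-median solution, i.e. `Σ_{p ∈ P} dist_1(Q, p) ≤ c·σ_med`.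
Suppose `C ⊆ P` is obtained by choosing, for each `q ∈ Q`, a set `N q` of exactly `ℓ`
points of `P` each within distance `dist_ℓ(P, q)` of `q`, and taking `C = ⋃_{q ∈ Q} N q`.
Then `|C| ≤ k` and `Σ_{p ∈ P} dist_ℓ(C, p) ≤ (1 + 4c)·σ_opt`. -/
theorem faultTolerant_kMedian_approx {M : Type*} [MetricSpace M] [DecidableEq M]
    (P : Finset M) (hP : P.Nonempty) (k ℓ : ℕ)
    (hl1 : 1 ≤ ℓ) (hlk : ℓ ≤ k) (hkP : k ≤ P.card)
    (σopt σmed : ℝ)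
    (hopt : IsLeast {x : ℝ | ∃ C : Finset M, C ⊆ P ∧ C.card = k ∧
      x = ∑ p ∈ P, kthDist C p ℓ} σopt)
    (hmed : IsLeast {x : ℝ | ∃ Q : Finset M, Q ⊆ P ∧ Q.card = k / ℓ ∧
      x = ∑ p ∈ P, kthDist Q p 1} σmed)
    (c : ℝ) (hc : 0 ≤ c)
    (Q : Finset M) (hQP : Q ⊆ P) (hQcard : Q.card = k / ℓ)
    (hQapprox : ∑ p ∈ P, kthDist Q p 1 ≤ c * σmed)
    (N : M → Finset M)
    (hN : ∀ q ∈ Q, N q ⊆ P ∧ (N q).card = ℓ ∧ ∀ x ∈ N q, dist q x ≤ kthDist P q ℓ)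
    (C : Finset M) (hC : C = Q.biUnion N) :
    C.card ≤ k ∧ ∑ p ∈ P, kthDist C p ℓ ≤ (1 + 4 * c) * σopt := by
  subst hC
  have hQne : Q.Nonempty := Finset.card_pos.1 (hQcard ▸ Nat.div_pos hlk hl1)
  have hlP : ℓ ≤ P.card := hlk.trans hkP
  refine ⟨?_, ?_⟩
  · calc (Q.biUnion N).card ≤ Q.card * ℓ :=
        Finset.card_biUnion_le_card_mul _ _ _ fun q hq => (hN q hq).2.1.le
      _ = k / ℓ * ℓ := by rw [hQcard]
      _ ≤ k := Nat.div_mul_le_self k ℓ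
  obtain ⟨⟨D, hDP, rfl, rfl⟩, -⟩ := hopt
  obtain ⟨R, hRP, hRcard, hR⟩ := exists_kthDist_one_le_two_mul hl1 hlk hDP
  have hmed_le : σmed ≤ 2 * ∑ p ∈ P, kthDist D p ℓ :=
    (hmed.2 ⟨R, hRP, hRcard, rfl⟩).trans (Finset.mul_sum P _ (2 : ℝ) ▸ Finset.sum_le_sum hR)
  have hpoint : ∀ p ∈ P,
      kthDist (Q.biUnion N) p ℓ ≤ 2 * kthDist Q p 1 + kthDist D p ℓ := by
    intro p _
    obtain ⟨q, hq, hpq⟩ := exists_mem_dist_le_kthDist_one hQne p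
    obtain ⟨-, hNcard, hNq⟩ := hN q hq
    have hqp := kthDist_le_dist_add q p hl1 hlP
    have hPD := kthDist_anti p hl1 hDP hlk
    refine kthDist_le_of_subset hl1 (Finset.subset_biUnion_of_mem N hq) hNcard.ge fun x hx => ?_
    rw [dist_comm q p] at hqp
    linarith [dist_triangle p q x, hNq x hx]
  calc ∑ p ∈ P, kthDist (Q.biUnion N) p ℓ
      ≤ ∑ p ∈ P, (2 * kthDist Q p 1 + kthDist D p ℓ) := Finset.sum_le_sum hpoint
    _ = 2 * ∑ p ∈ P, kthDist Q p 1 + ∑ p ∈ P, kthDist D p ℓ := by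
      rw [Finset.sum_add_distrib, Finset.mul_sum]
    _ ≤ (1 + 4 * c) * ∑ p ∈ P, kthDist D p ℓ := by
      linarith [mul_le_mul_of_nonneg_left hmed_le hc]
end
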